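/- arXiv:2110.11277 — 2 statements merged into one kernel-verified Lean document; each statement's English description precedes it below -/
import Mathlib

section
/- Let erfc(z) := (2/√π) ∫_z^∞ e^{−u²} du and, for s > 0 and w ∈ (0,1), let Φ(s, w) := Σ_{k∈ℤ} sgn(2k + w) · erfc(|2k + w| / (2√s)). Fix D > 0, l > 0, and x_0 ∈ (0, l/2), and define F_1(t) := Φ(Dt/l², 1 − x_0/l) for t > 0. Then F_1(t) ∼ √(4D/(π (l − x_0)²)) · t^{1/2} · e^{−(l − x_0)²/(4Dt)} as t → 0+. -/
open MeasureTheory Filter Set Real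
open scoped Topology

/-- The complementary error function `erfc z = (2/√π) ∫_z^∞ e^{-u²} du`. -/
noncomputable def erfc (z : ℝ) : ℝ :=
  (2 / Real.sqrt Real.pi) * ∫ u in Set.Ioi z, Real.exp (-u ^ 2)

/-- The short-time expansion `Φ(s,w) = Σ_{k∈ℤ} sgn(2k+w) erfc(|2k+w|/(2√s))`. -/
noncomputable def PhiShort (s w : ℝ) : ℝ :=
  ∑' k : ℤ, Real.sign (2 * (k : ℝ) + w) * erfc (|2 * (k : ℝ) + w| / (2 * Real.sqrt s))

lemma aux_exp_tendsto : Tendsto (fun u : ℝ => Real.exp (-u ^ 2)) atTop (𝓝 0) := by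
  have h : Tendsto (fun u : ℝ => u ^ 2) atTop atTop := tendsto_pow_atTop (by norm_num)
  exact Real.tendsto_exp_neg_atTop_nhds_zero.comp h

lemma aux_hasDeriv (u : ℝ) :
    HasDerivAt (fun u : ℝ => Real.exp (-u ^ 2)) (Real.exp (-u ^ 2) * (-(2 * u))) u := by
  have h := ((hasDerivAt_pow 2 u).neg).exp
  simpa using h

lemma aux_int (z : ℝ) : IntegrableOn (fun u : ℝ => Real.exp (-u ^ 2)) (Ioi z) := by
  have h := (integrable_exp_neg_mul_sq (b := 1) one_pos).integrableOn (s := Ioi z)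
  simpa using h

lemma erfc_upper (z : ℝ) (hz : 0 < z) : erfc z * (z * √π * Real.exp (z ^ 2)) ≤ 1 := by
  have hd : ∀ u ∈ Ici z, HasDerivAt (fun u : ℝ => -Real.exp (-u ^ 2) / (2 * z))
      (Real.exp (-u ^ 2) * (u / z)) u := by
    intro u _
    have := ((aux_hasDeriv u).neg).div_const (2 * z)
    refine HasDerivAt.congr_deriv this ?_
    field_simp
  have hpos : ∀ u ∈ Ioi z, 0 ≤ Real.exp (-u ^ 2) * (u / z) := by
    intro u hu
    have : 0 < u := hz.trans hu
    positivity
  have ht : Tendsto (fun u : ℝ => -Real.exp (-u ^ 2) / (2 * z)) atTop (𝓝 0) := by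
    simpa using (aux_exp_tendsto.neg).div_const (2 * z)
  have hi := integrableOn_Ioi_deriv_of_nonneg' hd hpos ht
  have he := integral_Ioi_of_hasDerivAt_of_tendsto' hd hi ht
  have hle : ∫ u in Ioi z, Real.exp (-u ^ 2) ≤ ∫ u in Ioi z, Real.exp (-u ^ 2) * (u / z) := by
    apply setIntegral_mono_on (aux_int z) hi measurableSet_Ioi
    intro u hu
    apply le_mul_of_one_le_right (Real.exp_pos _).le
    rw [one_le_div hz]
    exact (mem_Ioi.1 hu).le
  rw [he] at hle
  have hp : 0 < √π := Real.sqrt_pos.2 Real.pi_pos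
  unfold erfc
  calc _ = (∫ u in Ioi z, Real.exp (-u ^ 2)) * (2 * z * Real.exp (z ^ 2)) := by
        field_simp
    _ ≤ (0 - -Real.exp (-z ^ 2) / (2 * z)) * (2 * z * Real.exp (z ^ 2)) := by gcongr
    _ = 1 := by
        rw [Real.exp_neg]; field_simp; simp

lemma erfc_lower (z : ℝ) (hz : 0 < z) :
    (1 + 1 / (2 * z ^ 2))⁻¹ ≤ erfc z * (z * √π * Real.exp (z ^ 2)) := by
  have hd : ∀ u ∈ Ici z, HasDerivAt (fun u : ℝ => -(Real.exp (-u ^ 2) / (2 * u)))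
      (Real.exp (-u ^ 2) * (1 + 1 / (2 * u ^ 2))) u := by
    intro u hu
    have hu0 : 0 < u := lt_of_lt_of_le hz hu
    have := ((aux_hasDeriv u).div ((hasDerivAt_id u).const_mul 2) (by simp; positivity)).neg
    refine HasDerivAt.congr_deriv this ?_
    simp only [id]
    field_simp
    ring
  have hpos : ∀ u ∈ Ioi z, 0 ≤ Real.exp (-u ^ 2) * (1 + 1 / (2 * u ^ 2)) := by
    intro u hu
    positivity
  have ht : Tendsto (fun u : ℝ => -(Real.exp (-u ^ 2) / (2 * u))) atTop (𝓝 0) := by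
    have h2 : Tendsto (fun u : ℝ => 2 * u) atTop atTop :=
      tendsto_id.const_mul_atTop (by norm_num)
    simpa using (aux_exp_tendsto.div_atTop h2).neg
  have hi := integrableOn_Ioi_deriv_of_nonneg' hd hpos ht
  have he := integral_Ioi_of_hasDerivAt_of_tendsto' hd hi ht
  have hle : ∫ u in Ioi z, Real.exp (-u ^ 2) * (1 + 1 / (2 * u ^ 2)) ≤
      ∫ u in Ioi z, Real.exp (-u ^ 2) * (1 + 1 / (2 * z ^ 2)) := by
    apply setIntegral_mono_on hi ((aux_int z).mul_const _) measurableSet_Ioi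
    intro u hu
    have : z ≤ u := (mem_Ioi.1 hu).le
    gcongr
  rw [he, integral_mul_const] at hle
  have hp : 0 < √π := Real.sqrt_pos.2 Real.pi_pos
  unfold erfc
  rw [inv_le_iff_one_le_mul₀ (by positivity)]
  calc (1:ℝ) = (0 - -(Real.exp (-z ^ 2) / (2 * z))) * (2 * z * Real.exp (z ^ 2)) := by
        rw [Real.exp_neg]; field_simp; simp
    _ ≤ ((∫ u in Ioi z, Real.exp (-u ^ 2)) * (1 + 1 / (2 * z ^ 2))) *
        (2 * z * Real.exp (z ^ 2)) := by gcongr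
    _ = _ := by field_simp

lemma erfc_tendsto :
    Tendsto (fun z => erfc z * (z * √π * Real.exp (z ^ 2))) atTop (𝓝 1) := by
  have h1 : Tendsto (fun z : ℝ => (1 + 1 / (2 * z ^ 2))⁻¹) atTop (𝓝 1) := by
    have h : Tendsto (fun u : ℝ => 2 * u ^ 2) atTop atTop :=
      (tendsto_pow_atTop (by norm_num)).const_mul_atTop (by norm_num)
    have h' := ((tendsto_const_nhds (x := (1:ℝ))).div_atTop h).const_add 1
    simpa using h'.inv₀ (by norm_num)
  refine tendsto_of_tendsto_of_tendsto_of_le_of_le' h1 tendsto_const_nhds ?_ ?_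
  · filter_upwards [eventually_gt_atTop 0] with z hz using erfc_lower z hz
  · filter_upwards [eventually_gt_atTop 0] with z hz using erfc_upper z hz

lemma erfc_nonneg' (z : ℝ) : 0 ≤ erfc z := by
  unfold erfc
  have : 0 ≤ ∫ u in Ioi z, Real.exp (-u ^ 2) :=
    integral_nonneg (fun u => (Real.exp_pos _).le)
  positivity

lemma abs_sign_le (x : ℝ) : |Real.sign x| ≤ 1 := by
  rcases Real.sign_apply_eq x with h | h | h <;> simp [h]

lemma coef_bound (w : ℝ) (hw0 : 0 < w) (hw1 : w < 1) (k : ℤ) :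
    4 * (1 - w) / w ^ 2 * |(k : ℝ)| ≤ (|2 * (k : ℝ) + w| / w) ^ 2 - 1 := by
  have h : (|2 * (k : ℝ) + w| / w) ^ 2 - 1 = (4 * k * (k + w)) / w ^ 2 := by
    rw [div_pow, sq_abs]; field_simp; ring
  rw [h, div_mul_eq_mul_div]
  gcongr ?_ / _
  rcases le_or_gt 0 k with hk | hk
  · rw [abs_of_nonneg (by exact_mod_cast hk)]
    rcases hk.eq_or_lt with h0 | h0
    · simp [← h0]
    · have : (1:ℝ) ≤ k := by exact_mod_cast h0
      nlinarith
  · rw [abs_of_neg (by exact_mod_cast hk)]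
    have : (k:ℝ) ≤ -1 := by exact_mod_cast (show k ≤ -1 by omega)
    nlinarith

lemma summable_exp_abs (c : ℝ) (hc : 0 < c) :
    Summable (fun k : ℤ => Real.exp (-(c * |(k : ℝ)|))) := by
  have h : Summable (fun n : ℕ => Real.exp (-(c * (n : ℝ)))) := by
    have := Real.summable_exp_nat_mul_iff.2 (show -c < 0 by linarith)
    refine this.congr ?_
    intro n; congr 1; ring
  apply Summable.of_nat_of_neg
  · simpa using h
  · simpa using h

lemma term_bound (a z : ℝ) (ha : 1 ≤ a) (hz : 1 ≤ z) :
    erfc (a * z) * (z * √π * Real.exp (z ^ 2)) ≤ Real.exp (-((a ^ 2 - 1) * z ^ 2)) := by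
  have hp : 0 < √π := Real.sqrt_pos.2 Real.pi_pos
  have h := erfc_upper (a * z) (by positivity)
  have h0 := erfc_nonneg' (a * z)
  have e : Real.exp (z ^ 2) =
      Real.exp ((a * z) ^ 2) * Real.exp (-((a ^ 2 - 1) * z ^ 2)) := by
    rw [← Real.exp_add]; congr 1; ring
  rw [e]
  calc _ = (erfc (a * z) * (1 * z * √π * Real.exp ((a * z) ^ 2))) *
        Real.exp (-((a ^ 2 - 1) * z ^ 2)) := by ring
    _ ≤ (erfc (a * z) * (a * z * √π * Real.exp ((a * z) ^ 2))) *
        Real.exp (-((a ^ 2 - 1) * z ^ 2)) := by gcongr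
    _ ≤ 1 * Real.exp (-((a ^ 2 - 1) * z ^ 2)) := by gcongr
    _ = _ := one_mul _

lemma series_tendsto (w : ℝ) (hw0 : 0 < w) (hw1 : w < 1) :
    Tendsto (fun z : ℝ => ∑' k : ℤ, Real.sign (2 * (k : ℝ) + w) *
      erfc (|2 * (k : ℝ) + w| / w * z) * (z * √π * Real.exp (z ^ 2))) atTop (𝓝 1) := by
  have hc : 0 < 4 * (1 - w) / w ^ 2 := by
    have : 0 < 1 - w := by linarith
    positivity
  have hp : 0 < √π := Real.sqrt_pos.2 Real.pi_pos
  have ha : ∀ k : ℤ, 1 ≤ |2 * (k : ℝ) + w| / w := by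
    intro k
    have h1 := coef_bound w hw0 hw1 k
    have h2 : 0 ≤ 4 * (1 - w) / w ^ 2 * |(k : ℝ)| := by positivity
    have h3 : 0 ≤ |2 * (k : ℝ) + w| / w := by positivity
    nlinarith
  have habs : ∀ (k : ℤ) (z : ℝ), 1 ≤ z → ‖Real.sign (2 * (k : ℝ) + w) *
      erfc (|2 * (k : ℝ) + w| / w * z) * (z * √π * Real.exp (z ^ 2))‖ ≤
      Real.exp (-(4 * (1 - w) / w ^ 2 * |(k : ℝ)| * z ^ 2)) := by
    intro k z hz
    have h1 := coef_bound w hw0 hw1 k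
    have h2 := term_bound _ z (ha k) hz
    have h3 : 0 ≤ erfc (|2 * (k : ℝ) + w| / w * z) * (z * √π * Real.exp (z ^ 2)) :=
      mul_nonneg (erfc_nonneg' _) (by positivity)
    rw [mul_assoc, norm_mul, Real.norm_eq_abs, Real.norm_eq_abs, abs_of_nonneg h3]
    calc _ ≤ 1 * (erfc (|2 * (k : ℝ) + w| / w * z) * (z * √π * Real.exp (z ^ 2))) := by
          gcongr; exact abs_sign_le _
      _ ≤ _ := by
          rw [one_mul]
          refine h2.trans ?_
          gcongr
  have key := tendsto_tsum_of_dominated_convergence (𝓕 := atTop)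
    (f := fun (z : ℝ) (k : ℤ) => Real.sign (2 * (k : ℝ) + w) *
      erfc (|2 * (k : ℝ) + w| / w * z) * (z * √π * Real.exp (z ^ 2)))
    (g := fun k : ℤ => if k = 0 then (1:ℝ) else 0)
    (summable_exp_abs _ hc) ?_ ?_
  · simpa using key
  · intro k
    by_cases hk : k = 0
    · subst hk
      have := erfc_tendsto
      simpa [Real.sign_of_pos hw0, abs_of_pos hw0, hw0.ne'] using this
    · simp only [hk, if_false]
      have hk' : 0 < |(k : ℝ)| := by positivity
      refine squeeze_zero_norm' (a := fun z : ℝ =>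
        Real.exp (-(4 * (1 - w) / w ^ 2 * |(k : ℝ)| * z ^ 2))) ?_ ?_
      · filter_upwards [eventually_ge_atTop 1] with z hz using habs k z hz
      · have h : Tendsto (fun u : ℝ => 4 * (1 - w) / w ^ 2 * |(k : ℝ)| * u ^ 2) atTop atTop :=
          (tendsto_pow_atTop (by norm_num)).const_mul_atTop (by positivity)
        exact Real.tendsto_exp_neg_atTop_nhds_zero.comp h
  · filter_upwards [eventually_ge_atTop 1] with z hz k
    refine (habs k z hz).trans ?_
    apply Real.exp_le_exp.2
    apply neg_le_neg
    apply le_mul_of_one_le_right (by positivity)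
    nlinarith

/-- **Short-time asymptotics of `F₁`, the probability of hitting `l` before `0` by time `t`.**
For `D > 0`, `l > 0`, `x₀ ∈ (0, l/2)` and `F₁(t) = Φ(Dt/l², 1 - x₀/l)`, one has
`F₁(t) ∼ √(4D/(π (l-x₀)²)) t^{1/2} e^{-(l-x₀)²/(4Dt)}` as `t → 0+`. -/
theorem far_target_short_time_asymptotics
    (D l x₀ : ℝ) (hD : 0 < D) (hl : 0 < l) (hx₀ : 0 < x₀) (hx₀l : x₀ < l / 2)
    (F₁ : ℝ → ℝ)
    (hF₁ : ∀ t : ℝ, F₁ t = PhiShort (D * t / l ^ 2) (1 - x₀ / l)) :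
    Tendsto
      (fun t : ℝ =>
        F₁ t / (Real.sqrt (4 * D / (Real.pi * (l - x₀) ^ 2)) * t ^ ((1 : ℝ) / 2) *
          Real.exp (-((l - x₀) ^ 2) / (4 * D * t))))
      (𝓝[>] 0) (𝓝 1) := by
  have hlx : 0 < l - x₀ := by linarith
  have hw0 : 0 < 1 - x₀ / l := by
    rw [sub_pos, div_lt_one hl]; linarith
  have hw1 : 1 - x₀ / l < 1 := by
    have : 0 < x₀ / l := by positivity
    linarith
  have hS := series_tendsto (1 - x₀ / l) hw0 hw1
  have hz : Tendsto (fun t : ℝ => (1 - x₀ / l) / (2 * √(D * t / l ^ 2))) (𝓝[>] 0) atTop := by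
    have h1 : Tendsto (fun t : ℝ => 2 * √(D * t / l ^ 2)) (𝓝[>] 0) (𝓝[>] 0) := by
      apply tendsto_nhdsWithin_of_tendsto_nhds_of_eventually_within
      · have : Continuous (fun t : ℝ => 2 * √(D * t / l ^ 2)) := by fun_prop
        have h := this.tendsto 0
        simp only [mul_zero, zero_div, Real.sqrt_zero] at h
        exact h.mono_left nhdsWithin_le_nhds
      · filter_upwards [self_mem_nhdsWithin] with t ht
        have : 0 < t := ht
        simp only [mem_Ioi]
        positivity
    have h2 := (tendsto_inv_nhdsGT_zero.comp h1).const_mul_atTop hw0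
    simpa [div_eq_mul_inv, Function.comp_def] using h2
  refine (hS.comp hz).congr' ?_
  filter_upwards [self_mem_nhdsWithin] with t ht
  have ht : 0 < t := ht
  have hp : 0 < √π := Real.sqrt_pos.2 Real.pi_pos
  have hDt : 0 < D * t := by positivity
  have hq : 0 < √(D * t) := Real.sqrt_pos.2 hDt
  have hs : √(D * t / l ^ 2) = √(D * t) / l := by
    rw [Real.sqrt_div hDt.le, Real.sqrt_sq hl.le]
  have hzv : (1 - x₀ / l) / (2 * √(D * t / l ^ 2)) = (l - x₀) / (2 * √(D * t)) := by
    rw [hs]; field_simp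
  have hden : √(4 * D / (π * (l - x₀) ^ 2)) * t ^ ((1 : ℝ) / 2) *
      Real.exp (-((l - x₀) ^ 2) / (4 * D * t)) =
      ((l - x₀) / (2 * √(D * t)) * √π * Real.exp (((l - x₀) / (2 * √(D * t))) ^ 2))⁻¹ := by
    rw [← Real.sqrt_eq_rpow, Real.sqrt_div (by positivity), Real.sqrt_mul Real.pi_pos.le,
      Real.sqrt_sq hlx.le, mul_inv, ← Real.exp_neg, div_pow, mul_pow, Real.sq_sqrt hDt.le,
      Real.sqrt_mul (by norm_num : (0:ℝ) ≤ 4), Real.sqrt_mul hD.le,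
      show (4:ℝ) = 2 ^ 2 by norm_num, Real.sqrt_sq (by norm_num : (0:ℝ) ≤ 2)]
    have e : -(l - x₀) ^ 2 / (2 ^ 2 * D * t) = -((l - x₀) ^ 2 / (2 ^ 2 * (D * t))) := by
      rw [neg_div, mul_assoc]
    rw [e]
    congr 1
    have := Real.sqrt_pos.2 hD
    have := Real.sqrt_pos.2 ht
    field_simp
  rw [hF₁, hden, div_inv_eq_mul, PhiShort, ← tsum_mul_right]
  simp only [Function.comp]
  apply tsum_congr
  intro k
  rw [div_mul_div_cancel₀ hw0.ne', hzv]
end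

section
/- Let φ(s, w) := (4πs³)^{−1/2} Σ_{k∈ℤ} (w + 2k) e^{−(w+2k)²/(4s)} for s > 0, w ∈ (0,1). Fix μ ∈ ℝ, D > 0, l > 0, and x_0 ∈ (0, l/2), and define F_0(t) := e^{−μ x_0/(2D)} ∫_0^t e^{−μ² s/(4D)} (D/l²) φ(Ds/l², x_0/l) ds for t > 0. Then F_0(t) ∼ e^{−μ x_0/(2D)} √(4D/(π x_0²)) · t^{1/2} · e^{−x_0²/(4Dt)} as t → 0+. -/
open MeasureTheory Filter Set Real
open scoped Topology

/-- `φ(s,w) = (4πs³)^{-1/2} Σ_{k∈ℤ} (w+2k) e^{-(w+2k)²/(4s)}`. -/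
noncomputable def phiDens (s w : ℝ) : ℝ :=
  (Real.sqrt (4 * Real.pi * s ^ 3))⁻¹ *
    ∑' k : ℤ, (w + 2 * (k : ℝ)) * Real.exp (-(w + 2 * (k : ℝ)) ^ 2 / (4 * s))

lemma aux_key (k : ℤ) (w : ℝ) (hw0 : 0 < w) (hw : w < 1 / 2) :
    |(k : ℝ)| / 2 ≤ k * (k + w) := by
  rcases lt_trichotomy k 0 with h | h | h
  · have h1 : (k : ℝ) ≤ -1 := by exact_mod_cast (by omega : k ≤ -1)
    rw [abs_of_nonpos (by linarith)]
    nlinarith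
  · simp [h]
  · have h1 : (1 : ℝ) ≤ k := by exact_mod_cast (by omega : 1 ≤ k)
    rw [abs_of_nonneg (by linarith)]
    nlinarith

lemma aux_summable : Summable (fun k : ℤ => (1 + 2 * |(k : ℝ)|) * Real.exp (-(|(k : ℝ)| / 2))) := by
  have h0 := Real.summable_pow_mul_exp_neg_nat_mul 0 (r := 1 / 2) (by norm_num)
  have h1 := Real.summable_pow_mul_exp_neg_nat_mul 1 (r := 1 / 2) (by norm_num)
  have h2 := h0.add (h1.mul_left 2)
  have h3 : Summable (fun n : ℕ => (1 + 2 * (n : ℝ)) * Real.exp (-((n : ℝ) / 2))) := by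
    refine h2.congr fun n => ?_
    rw [show -((n : ℝ) / 2) = -(1 / 2) * n by ring]
    ring
  apply Summable.of_nat_of_neg
  · simpa using h3
  · simpa using h3

lemma aux_term (k : ℤ) (w s : ℝ) (hs : 0 < s) :
    (w + 2 * (k : ℝ)) * Real.exp (-(w + 2 * (k : ℝ)) ^ 2 / (4 * s)) * Real.exp (w ^ 2 / (4 * s))
      = (w + 2 * (k : ℝ)) * Real.exp (-(k * (k + w)) * s⁻¹) := by
  rw [mul_assoc, ← Real.exp_add]
  congr 2
  field_simp
  ring

lemma aux_S (w : ℝ) (hw0 : 0 < w) (hw : w < 1 / 2) :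
    Tendsto (fun s : ℝ => (∑' k : ℤ, (w + 2 * (k : ℝ)) *
      Real.exp (-(w + 2 * (k : ℝ)) ^ 2 / (4 * s))) * Real.exp (w ^ 2 / (4 * s)))
      (𝓝[>] 0) (𝓝 w) := by
  have hlim : ∑' k : ℤ, (if k = 0 then w else 0) = w := by simp
  have key : Tendsto (fun s : ℝ => ∑' k : ℤ, (w + 2 * (k : ℝ)) * Real.exp (-(k * (k + w)) * s⁻¹))
      (𝓝[>] 0) (𝓝 (∑' k : ℤ, (if k = 0 then w else 0))) := by
    apply tendsto_tsum_of_dominated_convergence aux_summable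
    · intro k
      by_cases hk : k = 0
      · simp [hk]
      · rw [if_neg hk]
        have hpos : 0 < (k : ℝ) * (k + w) := by
          have := aux_key k w hw0 hw
          have h2 : 0 < |(k : ℝ)| := by positivity
          linarith
        have h1 : Tendsto (fun s : ℝ => -(k * (k + w)) * s⁻¹) (𝓝[>] 0) atBot :=
          tendsto_inv_nhdsGT_zero.const_mul_atTop_of_neg (by linarith)
        have h2 := (Real.tendsto_exp_atBot.comp h1).const_mul (w + 2 * (k : ℝ))
        simpa using h2
    · have : Ioc (0 : ℝ) 1 ∈ 𝓝[>] (0 : ℝ) := Ioc_mem_nhdsGT one_pos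
      filter_upwards [this] with s hs k
      rw [norm_mul, Real.norm_eq_abs, Real.norm_eq_abs, abs_of_pos (Real.exp_pos _)]
      have hk := aux_key k w hw0 hw
      have hs1 : 1 ≤ s⁻¹ := (one_le_inv₀ hs.1).2 hs.2
      gcongr
      · calc |w + 2 * (k : ℝ)| ≤ |w| + |2 * (k : ℝ)| := abs_add_le _ _
          _ ≤ 1 + 2 * |(k : ℝ)| := by
            rw [abs_of_pos hw0, abs_mul, abs_of_pos (by norm_num : (0 : ℝ) < 2)]
            linarith
      · have : 0 ≤ |(k : ℝ)| := abs_nonneg _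
        nlinarith
  rw [hlim] at key
  refine key.congr' ?_
  filter_upwards [self_mem_nhdsWithin] with s hs
  rw [← tsum_mul_right]
  exact tsum_congr fun k => (aux_term k w s hs).symm

lemma aux_lhop (f g g' : ℝ → ℝ) (hf : Measurable f) (hg : ContinuousOn g (Ici 0)) (hg0 : g 0 = 0)
    (hd : ∀ s, 0 < s → HasDerivAt g (g' s) s) (hpos : ∀ s, 0 < s → 0 < g' s)
    (hgpos : ∀ s, 0 < s → 0 < g s)
    (hlim : Tendsto (fun s => f s / g' s) (𝓝[>] 0) (𝓝 1)) :
    Tendsto (fun t => (∫ s in Ioc (0 : ℝ) t, f s) / g t) (𝓝[>] 0) (𝓝 1) := by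
  rw [Metric.tendsto_nhds]
  intro ε hε
  have h1 := (Metric.tendsto_nhds.1 hlim) (ε / 2) (by positivity)
  rw [eventually_iff, mem_nhdsGT_iff_exists_Ioo_subset] at h1
  obtain ⟨δ, hδ, hsub⟩ := h1
  filter_upwards [Ioo_mem_nhdsGT hδ] with t ht
  have hgc : ContinuousOn g (Icc 0 t) := hg.mono fun x hx => hx.1
  have hint : IntegrableOn g' (Ioc 0 t) := intervalIntegral.integrableOn_deriv_of_nonneg hgc
    (fun x hx => hd x hx.1) (fun x hx => (hpos x hx.1).le)
  have hI : ∫ s in Ioc 0 t, g' s = g t := by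
    have := intervalIntegral.integral_eq_sub_of_hasDerivAt_of_le ht.1.le hgc
      (fun x hx => hd x hx.1) ((intervalIntegrable_iff_integrableOn_Ioc_of_le ht.1.le).2 hint)
    rw [intervalIntegral.integral_of_le ht.1.le, hg0, sub_zero] at this
    exact this
  have hb : ∀ s ∈ Ioc 0 t, ‖f s - g' s‖ ≤ ε / 2 * g' s := by
    intro s hs
    have h2 : dist (f s / g' s) 1 < ε / 2 := hsub ⟨hs.1, hs.2.trans_lt ht.2⟩
    have hp := hpos s hs.1
    rw [Real.dist_eq] at h2
    have : f s - g' s = (f s / g' s - 1) * g' s := by field_simp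
    rw [this, norm_mul, Real.norm_eq_abs, Real.norm_eq_abs, abs_of_pos hp]
    gcongr
  have hb' : ∀ᵐ s ∂(volume.restrict (Ioc 0 t)), ‖f s - g' s‖ ≤ ε / 2 * g' s :=
    (ae_restrict_iff' measurableSet_Ioc).2 (Eventually.of_forall hb)
  have hint2 : Integrable (fun s => f s - g' s) (volume.restrict (Ioc 0 t)) :=
    Integrable.mono' (hint.const_mul (ε / 2))
      (hf.aestronglyMeasurable.sub hint.aestronglyMeasurable) hb'
  have hle := norm_integral_le_of_norm_le (hint.const_mul (ε / 2)) hb'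
  have hfi : Integrable f (volume.restrict (Ioc 0 t)) :=
    (hint2.add hint).congr (Eventually.of_forall fun s => by simp)
  rw [integral_sub hfi hint, integral_const_mul, hI, Real.norm_eq_abs] at hle
  have hgt := hgpos t ht.1
  rw [Real.dist_eq, show (∫ s in Ioc (0 : ℝ) t, f s) / g t - 1
    = ((∫ s in Ioc (0 : ℝ) t, f s) - g t) / g t by field_simp, abs_div, abs_of_pos hgt,
    div_lt_iff₀ hgt]
  nlinarith

lemma aux_meas (w : ℝ) : Measurable (fun s => phiDens s w) := by
  unfold phiDens
  apply Measurable.mul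
  · fun_prop
  · apply Measurable.tsum
    intro k
    fun_prop

lemma aux_coef (D l x₀ s : ℝ) (hD : 0 < D) (hl : 0 < l) (hx₀ : 0 < x₀) (hs : 0 < s) :
    (D / l ^ 2) * (Real.sqrt (4 * Real.pi * (D * s / l ^ 2) ^ 3))⁻¹ * (x₀ / l) =
      Real.sqrt (4 * D / (Real.pi * x₀ ^ 2)) * (x₀ ^ 2 / (4 * D)) / (s * Real.sqrt s) := by
  obtain ⟨p, hp, hp2⟩ : ∃ p : ℝ, 0 < p ∧ Real.pi = p ^ 2 :=
    ⟨√π, by positivity, (Real.sq_sqrt pi_pos.le).symm⟩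
  obtain ⟨d, hd, rfl⟩ : ∃ p : ℝ, 0 < p ∧ D = p ^ 2 :=
    ⟨√D, by positivity, (Real.sq_sqrt hD.le).symm⟩
  obtain ⟨r, hr, rfl⟩ : ∃ p : ℝ, 0 < p ∧ s = p ^ 2 :=
    ⟨√s, by positivity, (Real.sq_sqrt hs.le).symm⟩
  rw [hp2, show 4 * p ^ 2 * (d ^ 2 * r ^ 2 / l ^ 2) ^ 3 = (2 * p * (d * r / l) ^ 3) ^ 2 by
    field_simp; ring, show 4 * d ^ 2 / (p ^ 2 * x₀ ^ 2) = (2 * d / (p * x₀)) ^ 2 by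
    field_simp; ring, Real.sqrt_sq (by positivity), Real.sqrt_sq (by positivity),
    Real.sqrt_sq hr.le]
  field_simp
  ring

lemma aux_deriv (C a s : ℝ) (hs : 0 < s) :
    HasDerivAt (fun s => C * √s * Real.exp (-a / s))
      (C / (s * √s) * Real.exp (-a / s) * (a + s / 2)) s := by
  have h1 : HasDerivAt (fun s : ℝ => -a / s) (a / s ^ 2) s := by
    have := (hasDerivAt_inv hs.ne').const_mul (-a)
    simp only [div_eq_mul_inv]
    refine this.congr_deriv ?_
    field_simp
  have h2 := ((Real.hasDerivAt_sqrt hs.ne').const_mul C).mul h1.exp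
  refine h2.congr_deriv ?_
  have h3 : √s * √s = s := Real.mul_self_sqrt hs.le
  have h4 : 0 < √s := by positivity
  generalize √s = r at *
  generalize Real.exp (-a / s) = e at *
  subst h3
  field_simp
  ring

/-- **Short-time asymptotics for drift-diffusion hitting the near target.**
For `μ ∈ ℝ`, `D > 0`, `l > 0`, `x₀ ∈ (0, l/2)` and
`F₀(t) = e^{-μx₀/(2D)} ∫_0^t e^{-μ²s/(4D)} (D/l²) φ(Ds/l², x₀/l) ds`, one has
`F₀(t) ∼ e^{-μx₀/(2D)} √(4D/(π x₀²)) t^{1/2} e^{-x₀²/(4Dt)}` as `t → 0+`. -/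
theorem drift_near_target_short_time_asymptotics
    (μ D l x₀ : ℝ) (hD : 0 < D) (hl : 0 < l) (hx₀ : 0 < x₀) (hx₀l : x₀ < l / 2)
    (F₀ : ℝ → ℝ)
    (hF₀ : ∀ t : ℝ, F₀ t = Real.exp (-μ * x₀ / (2 * D)) *
        ∫ s in Ioc (0 : ℝ) t,
          Real.exp (-μ ^ 2 * s / (4 * D)) * (D / l ^ 2) *
            phiDens (D * s / l ^ 2) (x₀ / l)) :
    Tendsto
      (fun t : ℝ =>
        F₀ t / (Real.exp (-μ * x₀ / (2 * D)) *
          Real.sqrt (4 * D / (Real.pi * x₀ ^ 2)) * t ^ ((1 : ℝ) / 2) *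
            Real.exp (-(x₀ ^ 2) / (4 * D * t))))
      (𝓝[>] 0) (𝓝 1) := by
  set C := Real.sqrt (4 * D / (Real.pi * x₀ ^ 2)) with hC
  have hCpos : 0 < C := by positivity
  set a := x₀ ^ 2 / (4 * D) with ha
  have hapos : 0 < a := by positivity
  have hw0 : 0 < x₀ / l := by positivity
  have hw : x₀ / l < 1 / 2 := by rw [div_lt_iff₀ hl]; linarith
  have hmain := aux_lhop
    (fun s => Real.exp (-μ ^ 2 * s / (4 * D)) * (D / l ^ 2) * phiDens (D * s / l ^ 2) (x₀ / l))
    (fun s => C * √s * Real.exp (-a / s))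
    (fun s => C / (s * √s) * Real.exp (-a / s) * (a + s / 2))
    (by
      have : Measurable (fun s => phiDens (D * s / l ^ 2) (x₀ / l)) :=
        (aux_meas (x₀ / l)).comp (by fun_prop : Measurable fun s : ℝ => D * s / l ^ 2)
      fun_prop)
    (by
      intro s hs
      rcases eq_or_lt_of_le (show (0 : ℝ) ≤ s from hs) with h | h
      · subst h
        have h0 : Tendsto (fun s : ℝ => C * √s) (𝓝[Ici 0] 0) (𝓝 0) := by
          have : Continuous (fun s : ℝ => C * √s) := by fun_prop
          simpa using (this.tendsto 0).mono_left nhdsWithin_le_nhds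
        simp only [ContinuousWithinAt, Real.sqrt_zero, mul_zero, zero_mul]
        refine squeeze_zero' ?_ ?_ h0
        · filter_upwards with s
          positivity
        · filter_upwards [self_mem_nhdsWithin] with s hs
          have hs : 0 ≤ s := hs
          have : Real.exp (-a / s) ≤ 1 := by
            rw [Real.exp_le_one_iff, neg_div]
            have : 0 ≤ a / s := by positivity
            linarith
          exact mul_le_of_le_one_right (by positivity) this
      · exact (aux_deriv C a s h).continuousAt.continuousWithinAt)
    (by simp) (fun s hs => aux_deriv C a s hs) (fun s hs => by positivity)
    (fun s hs => by positivity)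
    (by
      have hu : Tendsto (fun s : ℝ => D * s / l ^ 2) (𝓝[>] 0) (𝓝[>] 0) := by
        apply tendsto_nhdsWithin_of_tendsto_nhds_of_eventually_within
        · have : Continuous (fun s : ℝ => D * s / l ^ 2) := by fun_prop
          simpa using (this.tendsto 0).mono_left nhdsWithin_le_nhds
        · filter_upwards [self_mem_nhdsWithin] with s hs
          have hs : 0 < s := hs
          exact mem_Ioi.2 (by positivity)
      have hS := (aux_S (x₀ / l) hw0 hw).comp hu
      have hE : Tendsto (fun s : ℝ => Real.exp (-μ ^ 2 * s / (4 * D)) * a / (x₀ / l * (a + s / 2)))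
          (𝓝[>] 0) (𝓝 (1 / (x₀ / l))) := by
        have : ContinuousAt
            (fun s : ℝ => Real.exp (-μ ^ 2 * s / (4 * D)) * a / (x₀ / l * (a + s / 2))) 0 := by
          apply ContinuousAt.div
          · fun_prop
          · fun_prop
          · simp only [zero_div, add_zero]; positivity
        have h2 := this.tendsto.mono_left (nhdsWithin_le_nhds (s := Ioi 0))
        convert h2 using 2
        simp
        field_simp
      have hprod := hE.mul hS
      rw [one_div_mul_cancel hw0.ne'] at hprod
      refine hprod.congr' ?_
      filter_upwards [self_mem_nhdsWithin] with s hs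
      have hs : 0 < s := hs
      have hco := aux_coef D l x₀ s hD hl hx₀ hs
      rw [← hC, ← ha] at hco
      simp only [Function.comp, phiDens]
      have hexp : Real.exp ((x₀ / l) ^ 2 / (4 * (D * s / l ^ 2))) = (Real.exp (-a / s))⁻¹ := by
        rw [← Real.exp_neg, ha]
        congr 1
        field_simp
      rw [hexp]
      generalize (∑' k : ℤ, (x₀ / l + 2 * (k : ℝ)) *
        Real.exp (-(x₀ / l + 2 * (k : ℝ)) ^ 2 / (4 * (D * s / l ^ 2)))) = S
      have hE0 := Real.exp_pos (-a / s)
      generalize Real.exp (-a / s) = e at *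
      generalize (Real.sqrt (4 * Real.pi * (D * s / l ^ 2) ^ 3))⁻¹ = Q at *
      have hr : 0 < √s := by positivity
      have has : 0 < a + s / 2 := by positivity
      generalize a + s / 2 = b at *
      have hco2 : D / l ^ 2 * Q = C * a / (s * √s) / (x₀ / l) := by
        rw [← hco]; field_simp
      rw [show Real.exp (-μ ^ 2 * s / (4 * D)) * (D / l ^ 2) * (Q * S) =
        Real.exp (-μ ^ 2 * s / (4 * D)) * (D / l ^ 2 * Q) * S by ring, hco2]
      field_simp)
  refine hmain.congr' ?_
  filter_upwards [self_mem_nhdsWithin] with t ht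
  have ht : 0 < t := ht
  rw [hF₀, ← Real.sqrt_eq_rpow, show -(x₀ ^ 2) / (4 * D * t) = -a / t by rw [ha]; field_simp,
    show Real.exp (-μ * x₀ / (2 * D)) * C * √t * Real.exp (-a / t) =
      Real.exp (-μ * x₀ / (2 * D)) * (C * √t * Real.exp (-a / t)) by ring,
    mul_div_mul_left _ _ (Real.exp_pos _).ne']
end
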